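/- Let H be a Hopf algebra acting on a finitely generated quadratic algebra S with action preserving the grading. Every fiber A_t|_{t=c} (c ∈ k) of a graded deformation A_t of A = S#H is isomorphic as a filtered algebra to a strong PBW deformation of S#H. -/

import Mathlib

open scoped TensorProduct

noncomputable section

namespace PaperTH

variable (k H V : Type*) [CommRing k] [Ring H] [AddCommGroup V] [Module k V]

section AlgebraPart
variable [Algebra k H]

/-- The free algebra on the `k`-module `H ⊕ V`; the tensor algebra over `H` of the free
`H`-bimodule `H ⊗ V ⊗ H` is the quotient of this by the relations `baseSet` below. -/
abbrev TF := TensorAlgebra k (H × V)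

/-- The `H`-generators. -/
noncomputable def jH : H →ₗ[k] TF k H V := (TensorAlgebra.ι k).comp (LinearMap.inl k H V)

/-- The `V`-generators (degree 1). -/
noncomputable def jV : V →ₗ[k] TF k H V := (TensorAlgebra.ι k).comp (LinearMap.inr k H V)

/-- Presentation relation: the relations making `H ↪ T_H(H⊗V⊗H)` an algebra map, together
with an arbitrary set `Q` of further relations set equal to `0`.  Thus
`RingQuot (presRel Q)` models `T_H(H⊗V⊗H)/(Q)`. -/
inductive presRel (Q : Set (TF k H V)) : TF k H V → TF k H V → Prop
  | mulH (h h' : H) : presRel Q (jH k H V h * jH k H V h') (jH k H V (h * h'))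
  | oneH : presRel Q (jH k H V 1) 1
  | mem {x : TF k H V} : x ∈ Q → presRel Q x 0

/-- Elements generating the two-sided ideal presenting `T_H(H⊗V⊗H)` from the free algebra. -/
def baseSet : Set (TF k H V) :=
  {x | (∃ h h', x = jH k H V h * jH k H V h' - jH k H V (h * h')) ∨ x = jH k H V 1 - 1}

/-- The two-sided ideal generated by a set, as a `k`-submodule. -/
noncomputable def twoSidedSpan {A : Type*} [Ring A] [Algebra k A] (s : Set A) :
    Submodule k A :=
  Submodule.span k {x | ∃ a p b, p ∈ s ∧ x = a * p * b}

/-- Degree-0 piece `H` (with its unit). -/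
noncomputable def HF : Submodule k (TF k H V) := LinearMap.range (jH k H V) ⊔ 1

/-- The `V`-part. -/
noncomputable def VF : Submodule k (TF k H V) := LinearMap.range (jV k H V)

/-- Degree-`n` piece of `T_H(H⊗V⊗H)`: sums of `h₀ v₁ h₁ ⋯ v_n h_n`. -/
noncomputable def gradeF (n : ℕ) : Submodule k (TF k H V) :=
  HF k H V * (VF k H V * HF k H V) ^ n

/-- Filtration `F_n`. -/
noncomputable def filtF (n : ℕ) : Submodule k (TF k H V) := ⨆ i ≤ n, gradeF k H V i

/-- `F_{n-1}` (with `F_{-1} = ⊥`). -/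
noncomputable def filtFpred (n : ℕ) : Submodule k (TF k H V) := ⨆ i < n, gradeF k H V i

/-- The image of `V ⊗ V` in degree 2. -/
noncomputable def iVV : V ⊗[k] V →ₗ[k] TF k H V :=
  (LinearMap.mul' k (TF k H V)).comp (TensorProduct.map (jV k H V) (jV k H V))

/-- The image of `V ⊗ H` in degree 1. -/
noncomputable def iVH : V ⊗[k] H →ₗ[k] TF k H V :=
  (LinearMap.mul' k (TF k H V)).comp (TensorProduct.map (jV k H V) (jH k H V))

end AlgebraPart

section BialgebraPart
variable [Bialgebra k H]

/-- The twisting map `τ : H ⊗ V → V ⊗ H`, `h ⊗ v ↦ Σ (h₁ · v) ⊗ h₂`. -/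
noncomputable def twistTau (act : H ⊗[k] V →ₗ[k] V) :
    H ⊗[k] V →ₗ[k] V ⊗[k] H :=
  (TensorProduct.map act LinearMap.id)
    ∘ₗ (TensorProduct.assoc k H V H).symm.toLinearMap
    ∘ₗ (TensorProduct.map LinearMap.id (TensorProduct.comm k H V).toLinearMap)
    ∘ₗ (TensorProduct.assoc k H H V).toLinearMap
    ∘ₗ (TensorProduct.map Coalgebra.comul LinearMap.id)

/-- The diagonal action of `H` on `V ⊗ V`. -/
noncomputable def diag2 (act : H ⊗[k] V →ₗ[k] V) :
    H ⊗[k] (V ⊗[k] V) →ₗ[k] V ⊗[k] V :=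
  (TensorProduct.map act act)
    ∘ₗ (TensorProduct.tensorTensorTensorComm k H H V V).toLinearMap
    ∘ₗ (TensorProduct.map Coalgebra.comul LinearMap.id)

/-- The span of the smash relations `h ⊗ v ⊗ 1 − 1 ⊗ τ(h ⊗ v)`, viewed inside `TF`. -/
noncomputable def smashSet (act : H ⊗[k] V →ₗ[k] V) : Set (TF k H V) :=
  (Submodule.span k {x | ∃ (h : H) (v : V),
    x = jH k H V h * jV k H V v - iVH k H V (twistTau k H V act (h ⊗ₜ[k] v))} :
      Submodule k (TF k H V))

end BialgebraPart

end PaperTH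

end

open PaperTH

noncomputable section

variable (k H V : Type*) [CommRing k] [Ring H] [Bialgebra k H]
  [AddCommGroup V] [Module k V]

/-- The homogeneous relations `R ∪ R'` presenting `S#H = T_H(H⊗V⊗H)/(R ∪ R')`. -/
noncomputable def fullRels (R : Submodule k (V ⊗[k] V)) (actV : H ⊗[k] V →ₗ[k] V) :
    Set (TF k H V) :=
  (iVV k H V '' (R : Set (V ⊗[k] V))) ∪ smashSet k H V actV

/-- The filtered (deformed) relations `P ∪ P'` of `H_{λ,α,β}`:
`P' = {r − λ(r) : r ∈ R'}` and `P = {r − α(r) − β(r) : r ∈ R}`. -/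
noncomputable def defRels (R : Submodule k (V ⊗[k] V)) (actV : H ⊗[k] V →ₗ[k] V)
    (lam : TF k H V →ₗ[k] TF k H V) (α β : V ⊗[k] V →ₗ[k] TF k H V) :
    Set (TF k H V) :=
  {x | ∃ y ∈ smashSet k H V actV, x = y - lam y} ∪
  {x | ∃ r ∈ R, x = iVV k H V r - α r - β r}

/-- The smash product `A = S#H`, as the quotient of the free presentation. -/
abbrev SmashAlg (R : Submodule k (V ⊗[k] V)) (actV : H ⊗[k] V →ₗ[k] V) :=
  RingQuot (presRel k H V (fullRels k H V R actV))

/-- Degree-`n` component of `A = S#H`. -/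
noncomputable def gradeA (R : Submodule k (V ⊗[k] V)) (actV : H ⊗[k] V →ₗ[k] V) (n : ℕ) :
    Submodule k (SmashAlg k H V R actV) :=
  Submodule.map
    (RingQuot.mkAlgHom k (presRel k H V (fullRels k H V R actV))).toLinearMap
    (gradeF k H V n)

/-- The `n`-th filtered piece of `A = S#H`. -/
noncomputable def filtA (R : Submodule k (V ⊗[k] V)) (actV : H ⊗[k] V →ₗ[k] V) (n : ℕ) :
    Submodule k (SmashAlg k H V R actV) :=
  Submodule.map
    (RingQuot.mkAlgHom k (presRel k H V (fullRels k H V R actV))).toLinearMap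
    (filtF k H V n)

/-- The PBW deformation `H_{λ,α,β}`, as a quotient of the free presentation. -/
abbrev DefAlg (R : Submodule k (V ⊗[k] V)) (actV : H ⊗[k] V →ₗ[k] V)
    (lam : TF k H V →ₗ[k] TF k H V) (α β : V ⊗[k] V →ₗ[k] TF k H V) :=
  RingQuot (presRel k H V (defRels k H V R actV lam α β))

/-- The `n`-th filtered piece of `H_{λ,α,β}`. -/
noncomputable def filtB (R : Submodule k (V ⊗[k] V)) (actV : H ⊗[k] V →ₗ[k] V)
    (lam : TF k H V →ₗ[k] TF k H V) (α β : V ⊗[k] V →ₗ[k] TF k H V) (n : ℕ) :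
    Submodule k (DefAlg k H V R actV lam α β) :=
  Submodule.map
    (RingQuot.mkAlgHom k (presRel k H V (defRels k H V R actV lam α β))).toLinearMap
    (filtF k H V n)

/-- `H_{λ,α,β}` is a strong PBW deformation of `S#H`: the canonical graded epimorphism
`S#H → gr H_{λ,α,β}` is injective in every degree (expressed at the level of the free
presentation, whose base relations generate the two-sided ideal `twoSidedSpan baseSet`). -/
def IsStrongPBWofSmash (R : Submodule k (V ⊗[k] V)) (actV : H ⊗[k] V →ₗ[k] V)
    (lam : TF k H V →ₗ[k] TF k H V) (α β : V ⊗[k] V →ₗ[k] TF k H V) : Prop :=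
  ∀ n, gradeF k H V n ⊓
      ((twoSidedSpan k (baseSet k H V)
        ⊔ twoSidedSpan k (defRels k H V R actV lam α β)) ⊔ filtFpred k H V n)
    ≤ twoSidedSpan k (baseSet k H V) ⊔ twoSidedSpan k (fullRels k H V R actV)

end

namespace PBWAux

section gen
variable {k H V : Type*} [CommRing k] [Ring H] [Algebra k H] [AddCommGroup V] [Module k V]

theorem filtF_eq (n : ℕ) : filtF k H V n = filtFpred k H V (n + 1) := by
  unfold filtF filtFpred
  simp only [Nat.lt_succ_iff]

theorem pred_zero : filtFpred k H V 0 = ⊥ := by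
  simp [filtFpred]

theorem pred_succ (n : ℕ) :
    filtFpred k H V (n + 1) = filtFpred k H V n ⊔ gradeF k H V n := by
  unfold filtFpred
  apply le_antisymm
  · refine iSup₂_le fun i hi => ?_
    rcases Nat.lt_succ_iff_lt_or_eq.mp hi with h | h
    · exact le_trans (le_iSup₂_of_le i h le_rfl) le_sup_left
    · subst h; exact le_sup_right
  · refine sup_le (iSup₂_le fun i hi => ?_) ?_
    · exact le_iSup₂_of_le i (by omega) le_rfl
    · exact le_iSup₂_of_le n (by omega) le_rfl

theorem pred_mono {m n : ℕ} (h : m ≤ n) : filtFpred k H V m ≤ filtFpred k H V n := by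
  unfold filtFpred
  exact iSup₂_le fun i hi => le_iSup₂_of_le i (by omega) le_rfl

theorem grade_le_pred {m n : ℕ} (h : m < n) : gradeF k H V m ≤ filtFpred k H V n := by
  unfold filtFpred
  exact le_iSup₂_of_le m h le_rfl

theorem one_le_HF : (1 : Submodule k (TF k H V)) ≤ HF k H V := le_sup_right

theorem jH_mem (h : H) : jH k H V h ∈ HF k H V :=
  Submodule.mem_sup_left ⟨h, rfl⟩

theorem grade_zero : gradeF k H V 0 = HF k H V := by
  simp [gradeF]

theorem grade_succ (n : ℕ) :
    gradeF k H V (n + 1) = gradeF k H V n * (VF k H V * HF k H V) := by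
  simp [gradeF, pow_succ, mul_assoc]

theorem jV_mem (v : V) : jV k H V v ∈ gradeF k H V 1 := by
  rw [grade_succ, grade_zero]
  have h1 : (1 : TF k H V) ∈ HF k H V := one_le_HF (Submodule.one_le.mp le_rfl)
  have := Submodule.mul_mem_mul h1 (Submodule.mul_mem_mul (M := VF k H V) ⟨v, rfl⟩ h1)
  simpa using this

variable {E : Type*} [Ring E] [Algebra k E]

/-- image of grade -/
noncomputable def gE (f : TF k H V →ₐ[k] E) (n : ℕ) : Submodule k E :=
  Submodule.map f.toLinearMap (gradeF k H V n)

/-- image of strict filtration -/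
noncomputable def lE (f : TF k H V →ₐ[k] E) (n : ℕ) : Submodule k E :=
  Submodule.map f.toLinearMap (filtFpred k H V n)

theorem lE_zero (f : TF k H V →ₐ[k] E) : lE f 0 = ⊥ := by
  simp [lE, pred_zero]

theorem lE_succ (f : TF k H V →ₐ[k] E) (n : ℕ) : lE f (n + 1) = lE f n ⊔ gE f n := by
  simp [lE, gE, pred_succ, Submodule.map_sup]

theorem lE_mono (f : TF k H V →ₐ[k] E) {m n : ℕ} (h : m ≤ n) : lE f m ≤ lE f n :=
  Submodule.map_mono (pred_mono h)

theorem gE_le (f : TF k H V →ₐ[k] E) {m n : ℕ} (h : m < n) : gE f m ≤ lE f n :=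
  Submodule.map_mono (grade_le_pred h)

theorem lE_eq (f : TF k H V →ₐ[k] E) (n : ℕ) : lE f n = ⨆ i < n, gE f i := by
  simp [lE, gE, filtFpred, Submodule.map_iSup]

/-- f respects base relations -/
def Base (f : TF k H V →ₐ[k] E) : Prop :=
  (∀ h h', f (jH k H V h) * f (jH k H V h') = f (jH k H V (h * h'))) ∧ f (jH k H V 1) = 1

theorem HF_map {f : TF k H V →ₐ[k] E} (hf : Base f) :
    Submodule.map f.toLinearMap (HF k H V) =
      LinearMap.range (f.toLinearMap ∘ₗ jH k H V) := by
  apply le_antisymm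
  · rw [HF, Submodule.map_sup]
    refine sup_le ?_ ?_
    · rw [LinearMap.range_comp]
    · rw [Submodule.map_le_iff_le_comap, Submodule.one_le]
      exact ⟨1, by simp [hf.2]⟩
  · rw [LinearMap.range_comp]
    exact Submodule.map_mono le_sup_left

theorem HF_mul {f : TF k H V →ₐ[k] E} (hf : Base f) :
    Submodule.map f.toLinearMap (HF k H V) * Submodule.map f.toLinearMap (HF k H V) ≤
      Submodule.map f.toLinearMap (HF k H V) := by
  rw [HF_map hf, Submodule.mul_le]
  rintro _ ⟨h, rfl⟩ _ ⟨h', rfl⟩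
  exact ⟨h * h', by simp [hf.1]⟩

theorem gE_mul {f : TF k H V →ₐ[k] E} (hf : Base f) (m n : ℕ) :
    gE f m * gE f n ≤ gE f (m + n) := by
  have hH : ∀ m, gE f m * Submodule.map f.toLinearMap (HF k H V) ≤ gE f m := by
    intro m
    cases m with
    | zero => rw [gE, grade_zero]; exact HF_mul hf
    | succ m =>
      rw [gE, grade_succ, Submodule.map_mul, Submodule.map_mul, mul_assoc, mul_assoc]
      gcongr
      exact HF_mul hf
  induction n with
  | zero => 
    have := hH m
    rwa [← grade_zero] at this
  | succ n ih =>
    rw [← add_assoc, gE, gE, gE, grade_succ, grade_succ, Submodule.map_mul, Submodule.map_mul (gradeF k H V (m + n)), ← mul_assoc]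
    gcongr
    exact ih

theorem lE_mul {f : TF k H V →ₐ[k] E} (hf : Base f) (m n p : ℕ) (hp : m + n ≤ p + 1) :
    lE f m * lE f n ≤ lE f p := by
  rw [lE_eq, lE_eq]
  simp only [Submodule.iSup_mul, Submodule.mul_iSup]
  refine iSup₂_le fun i hi => iSup₂_le fun j hj => ?_
  refine (gE_mul hf _ _).trans ?_
  exact gE_le f (by omega)

theorem one_mem_lE (f : TF k H V →ₐ[k] E) : (1 : E) ∈ lE f 1 :=
  ⟨1, grade_le_pred (Nat.zero_lt_one) (by
    rw [grade_zero]; exact one_le_HF (Submodule.one_le.mp le_rfl)), by simp⟩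

theorem exhaust {f : TF k H V →ₐ[k] E} (hf : Base f) (x : TF k H V) :
    ∃ n, f x ∈ lE f n := by
  induction x using TensorAlgebra.induction with
  | algebraMap r =>
    refine ⟨1, ?_⟩
    rw [AlgHom.commutes, Algebra.algebraMap_eq_smul_one]
    exact Submodule.smul_mem _ _ (one_mem_lE f)
  | ι m =>
    refine ⟨2, TensorAlgebra.ι k m, ?_, rfl⟩
    have : TensorAlgebra.ι k m = jH k H V m.1 + jV k H V m.2 := by
      simp [jH, jV, ← map_add]
    rw [this]
    refine Submodule.add_mem _ ?_ ?_
    · exact grade_le_pred (m := 0) (by omega) (by rw [grade_zero]; exact jH_mem _)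
    · exact grade_le_pred (m := 1) (by omega) (jV_mem _)
  | mul a b ha hb =>
    obtain ⟨m, ha⟩ := ha
    obtain ⟨n, hb⟩ := hb
    exact ⟨m + n, by rw [map_mul]; exact lE_mul hf m n _ (by omega) (Submodule.mul_mem_mul ha hb)⟩
  | add a b ha hb =>
    obtain ⟨m, ha⟩ := ha
    obtain ⟨n, hb⟩ := hb
    exact ⟨m + n, by rw [map_add]; exact Submodule.add_mem _ (lE_mono f (by omega) ha) (lE_mono f (by omega) hb)⟩

/-- algebra hom to E[X] tracking degree -/
noncomputable def grHom (f : TF k H V →ₐ[k] E) : TF k H V →ₐ[k] Polynomial E :=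
  TensorAlgebra.lift k
    (((Polynomial.monomial 0).restrictScalars k ∘ₗ f.toLinearMap ∘ₗ jH k H V) ∘ₗ LinearMap.fst k H V +
     ((Polynomial.monomial 1).restrictScalars k ∘ₗ f.toLinearMap ∘ₗ jV k H V) ∘ₗ LinearMap.snd k H V)

theorem grHom_jH (f : TF k H V →ₐ[k] E) (h : H) :
    grHom f (jH k H V h) = Polynomial.monomial 0 (f (jH k H V h)) := by
  simp [grHom, jH]

theorem grHom_jV (f : TF k H V →ₐ[k] E) (v : V) :
    grHom f (jV k H V v) = Polynomial.monomial 1 (f (jV k H V v)) := by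
  simp [grHom, jV]

theorem grHom_HF (f : TF k H V →ₐ[k] E) (x : TF k H V) (hx : x ∈ HF k H V) :
    grHom f x = Polynomial.monomial 0 (f x) := by
  have : HF k H V ≤ LinearMap.eqLocus (grHom f).toLinearMap
      ((Polynomial.monomial 0).restrictScalars k ∘ₗ f.toLinearMap) := by
    refine sup_le ?_ ?_
    · rintro _ ⟨h, rfl⟩
      exact grHom_jH f h
    · rw [Submodule.one_le]
      simp
  exact this hx

theorem grHom_grade (f : TF k H V →ₐ[k] E) (n : ℕ) (x : TF k H V) (hx : x ∈ gradeF k H V n) :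
    grHom f x = Polynomial.monomial n (f x) := by
  induction n generalizing x with
  | zero => rw [grade_zero] at hx; exact grHom_HF f x hx
  | succ n ih =>
    have : gradeF k H V (n+1) ≤ LinearMap.eqLocus (grHom f).toLinearMap
      ((Polynomial.monomial (n+1)).restrictScalars k ∘ₗ f.toLinearMap) := by
      rw [grade_succ, Submodule.mul_le]
      intro a ha b hb
      have hb' : grHom f b = Polynomial.monomial 1 (f b) := by
        have : VF k H V * HF k H V ≤ LinearMap.eqLocus (grHom f).toLinearMap
          ((Polynomial.monomial 1).restrictScalars k ∘ₗ f.toLinearMap) := by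
          rw [Submodule.mul_le]
          rintro _ ⟨v, rfl⟩ y hy
          simp [grHom_jV, grHom_HF f y hy]
        exact this hb
      simp [ih a ha, hb', Polynomial.monomial_mul_monomial]
    exact this hx

theorem grHom_mul' (f : TF k H V →ₐ[k] E) (r : V ⊗[k] V) :
    grHom f (iVV k H V r) = Polynomial.monomial 2 (f (iVV k H V r)) := by
  induction r using TensorProduct.induction_on with
  | zero => simp
  | tmul x y => simp [iVV, grHom_jV, Polynomial.monomial_mul_monomial]
  | add x y hx hy => simp [map_add, hx, hy]

theorem grHom_iVH (f : TF k H V →ₐ[k] E) (r : V ⊗[k] H) :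
    grHom f (iVH k H V r) = Polynomial.monomial 1 (f (iVH k H V r)) := by
  induction r using TensorProduct.induction_on with
  | zero => simp
  | tmul x y => simp [iVH, grHom_jV, grHom_jH]
  | add x y hx hy => simp [map_add, hx, hy]

theorem grHom_coeff {f : TF k H V →ₐ[k] E} (hf : Base f) (x : TF k H V) (n : ℕ) :
    (grHom f x).coeff n ∈ lE f (n + 1) := by
  induction x using TensorAlgebra.induction generalizing n with
  | algebraMap r =>
    rw [AlgHom.commutes, Polynomial.algebraMap_apply, Polynomial.coeff_C]
    split_ifs with h
    · subst h
      rw [Algebra.algebraMap_eq_smul_one]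
      exact Submodule.smul_mem _ _ (one_mem_lE f)
    · exact Submodule.zero_mem _
  | ι m =>
    have : TensorAlgebra.ι k m = jH k H V m.1 + jV k H V m.2 := by
      simp [jH, jV, ← map_add]
    rw [this, map_add, grHom_jH, grHom_jV, Polynomial.coeff_add, Polynomial.coeff_monomial, Polynomial.coeff_monomial]
    refine Submodule.add_mem _ ?_ ?_
    · split_ifs with h
      · exact gE_le f (m := 0) (by omega) ⟨_, by rw [grade_zero]; exact jH_mem _, rfl⟩
      · exact Submodule.zero_mem _
    · split_ifs with h
      · exact gE_le f (m := 1) (by omega) ⟨_, jV_mem _, rfl⟩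
      · exact Submodule.zero_mem _
  | mul a b ha hb =>
    rw [map_mul, Polynomial.coeff_mul]
    refine Submodule.sum_mem _ fun p hp => ?_
    have hp := Finset.HasAntidiagonal.mem_antidiagonal.mp hp
    exact lE_mul hf (p.1+1) (p.2+1) _ (by omega) (Submodule.mul_mem_mul (ha _) (hb _))
  | add a b ha hb =>
    rw [map_add, Polynomial.coeff_add]
    exact Submodule.add_mem _ (ha n) (hb n)

/-- The kernel of the presentation map. -/
theorem tss_mul_left (s : Set E) (a x : E) (hx : x ∈ twoSidedSpan k s) : a * x ∈ twoSidedSpan k s := by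
  have : twoSidedSpan k s ≤ (twoSidedSpan k s).comap (LinearMap.mulLeft k a) := by
    rw [twoSidedSpan, Submodule.span_le]
    rintro _ ⟨u, p, v, hp, rfl⟩
    exact Submodule.subset_span ⟨a * u, p, v, hp, by simp [mul_assoc]⟩
  exact this hx

theorem tss_mul_right (s : Set E) (a x : E) (hx : x ∈ twoSidedSpan k s) : x * a ∈ twoSidedSpan k s := by
  have : twoSidedSpan k s ≤ (twoSidedSpan k s).comap (LinearMap.mulRight k a) := by
    rw [twoSidedSpan, Submodule.span_le]
    rintro _ ⟨u, p, v, hp, rfl⟩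
    exact Submodule.subset_span ⟨u, p, v * a, hp, by simp [mul_assoc]⟩
  exact this hx

theorem tss_sub (s : Set E) : s ⊆ twoSidedSpan k s := fun x hx =>
  Submodule.subset_span ⟨1, x, 1, hx, by simp⟩

theorem mk_ker (Q : Set (TF k H V)) (x : TF k H V)
    (hx : RingQuot.mkAlgHom k (presRel k H V Q) x = 0) :
    x ∈ twoSidedSpan k (baseSet k H V) ⊔ twoSidedSpan k Q := by
  set I := twoSidedSpan k (baseSet k H V) ⊔ twoSidedSpan k Q with hI
  have hl : ∀ a x, x ∈ I → a * x ∈ I := by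
    intro a x hx
    obtain ⟨y, hy, z, hz, rfl⟩ := Submodule.mem_sup.mp hx
    rw [mul_add]
    exact Submodule.add_mem_sup (tss_mul_left _ _ _ hy) (tss_mul_left _ _ _ hz)
  have hr : ∀ a x, x ∈ I → x * a ∈ I := by
    intro a x hx
    obtain ⟨y, hy, z, hz, rfl⟩ := Submodule.mem_sup.mp hx
    rw [add_mul]
    exact Submodule.add_mem_sup (tss_mul_right _ _ _ hy) (tss_mul_right _ _ _ hz)
  let J : TwoSidedIdeal (TF k H V) := TwoSidedIdeal.mk' (I : Set (TF k H V)) I.zero_mem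
    (fun h h' => I.add_mem h h') (fun h => I.neg_mem h) (fun h => hl _ _ h) (fun h => hr _ _ h)
  have hJ : ∀ y, y ∈ J ↔ y ∈ I := fun y => TwoSidedIdeal.mem_mk' _ _ _ _ _ _ _
  let q : TF k H V →+* J.ringCon.Quotient := J.ringCon.mk'
  have hq : ∀ a b, a - b ∈ I → q a = q b := by
    intro a b hab
    refine (RingCon.eq _).mpr ?_
    rw [TwoSidedIdeal.rel_iff, hJ]; exact hab
  have hrel : ∀ ⦃a b⦄, presRel k H V Q a b → q a = q b := by
    intro a b hab
    apply hq
    cases hab with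
    | mulH h h' => exact Submodule.mem_sup_left (tss_sub _ (Or.inl ⟨h, h', rfl⟩))
    | oneH => exact Submodule.mem_sup_left (tss_sub _ (Or.inr rfl))
    | mem hb => rw [sub_zero]; exact Submodule.mem_sup_right (tss_sub _ hb)
  have key : q x = q 0 := by
    rw [← RingQuot.lift_mkRingHom_apply q hrel x, ← RingQuot.mkAlgHom_coe k, RingHom.coe_coe, hx, map_zero, map_zero]
  have := (RingCon.eq _).mp key
  rw [TwoSidedIdeal.rel_iff, hJ, sub_zero] at this
  exact this

theorem base_mk (Q : Set (TF k H V)) : Base (RingQuot.mkAlgHom k (presRel k H V Q)) := by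
  refine ⟨fun h h' => ?_, ?_⟩
  · rw [← map_mul]; exact RingQuot.mkAlgHom_rel k (presRel.mulH h h')
  · rw [RingQuot.mkAlgHom_rel k presRel.oneH, map_one]

theorem mk_mem (Q : Set (TF k H V)) {x} (hx : x ∈ Q) :
    RingQuot.mkAlgHom k (presRel k H V Q) x = 0 := by
  rw [RingQuot.mkAlgHom_rel k (presRel.mem hx), map_zero]

end gen
end PBWAux
namespace PBWAux

section comp
variable {k H V : Type*} [CommRing k] [Ring H] [Algebra k H] [AddCommGroup V] [Module k V]
  {A Ac : Type*} [Ring A] [Algebra k A] [Ring Ac] [Algebra k Ac]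

/-- Almost multiplicative maps. -/
def Star (π : TF k H V →ₐ[k] A) (e : A ≃ₗ[k] Ac) : Prop :=
  e 1 = 1 ∧ ∀ m n, ∀ a ∈ gE π m, ∀ b ∈ gE π n,
    e a * e b - e (a * b) ∈ Submodule.map e.toLinearMap (lE π (m + n))

theorem Lc_mul {π : TF k H V →ₐ[k] A} (hπ : Base π) {e : A ≃ₗ[k] Ac} (hs : Star π e)
    (m n p : ℕ) (hp : m + n ≤ p + 1) :
    Submodule.map e.toLinearMap (lE π m) * Submodule.map e.toLinearMap (lE π n) ≤
      Submodule.map e.toLinearMap (lE π p) := by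
  rw [lE_eq π m, lE_eq π n]
  simp only [Submodule.map_iSup, Submodule.iSup_mul, Submodule.mul_iSup]
  refine iSup₂_le fun i hi => iSup₂_le fun j hj => ?_
  rw [Submodule.mul_le]
  rintro _ ⟨a, ha, rfl⟩ _ ⟨b, hb, rfl⟩
  have h1 := hs.2 _ _ a ha b hb
  have h2 : e (a * b) ∈ Submodule.map e.toLinearMap (lE π p) :=
    ⟨a * b, gE_le π (by omega) (gE_mul hπ _ _ (Submodule.mul_mem_mul ha hb)), rfl⟩
  have h3 := Submodule.add_mem _ (Submodule.map_mono (lE_mono π (n := p) (by omega)) h1) h2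
  simpa using h3

/-- the lift -/
noncomputable def phi (π : TF k H V →ₐ[k] A) (e : A ≃ₗ[k] Ac) : TF k H V →ₐ[k] Ac :=
  TensorAlgebra.lift k (e.toLinearMap ∘ₗ π.toLinearMap ∘ₗ TensorAlgebra.ι k)

theorem phi_jH (π : TF k H V →ₐ[k] A) (e : A ≃ₗ[k] Ac) (h : H) :
    phi π e (jH k H V h) = e (π (jH k H V h)) := by
  simp [phi, jH]

theorem phi_jV (π : TF k H V →ₐ[k] A) (e : A ≃ₗ[k] Ac) (v : V) :
    phi π e (jV k H V v) = e (π (jV k H V v)) := by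
  simp [phi, jV]

theorem phi_HF (π : TF k H V →ₐ[k] A) {e : A ≃ₗ[k] Ac} (hs : Star π e)
    (x : TF k H V) (hx : x ∈ HF k H V) : phi π e x = e (π x) := by
  have : HF k H V ≤ LinearMap.eqLocus (phi π e).toLinearMap
      (e.toLinearMap ∘ₗ π.toLinearMap) := by
    refine sup_le ?_ ?_
    · rintro _ ⟨h, rfl⟩
      exact phi_jH π e h
    · rw [Submodule.one_le]
      simp [hs.1]
  exact this hx

theorem phi_base {π : TF k H V →ₐ[k] A} (hπ : Base π) {e : A ≃ₗ[k] Ac} (hs : Star π e) :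
    Base (phi π e) := by
  refine ⟨fun h h' => ?_, ?_⟩
  · have h1 := hs.2 0 0 (π (jH k H V h)) ⟨_, by rw [grade_zero]; exact jH_mem _, rfl⟩
      (π (jH k H V h')) ⟨_, by rw [grade_zero]; exact jH_mem _, rfl⟩
    rw [lE_zero, Submodule.map_bot, Submodule.mem_bot, sub_eq_zero, hπ.1] at h1
    simpa [phi_jH] using h1
  · rw [phi_jH, hπ.2, hs.1]

/-- difference map -/
noncomputable def dif (π : TF k H V →ₐ[k] A) (e : A ≃ₗ[k] Ac) : TF k H V →ₗ[k] Ac :=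
  (phi π e).toLinearMap - e.toLinearMap ∘ₗ π.toLinearMap

theorem dif_apply (π : TF k H V →ₐ[k] A) (e : A ≃ₗ[k] Ac) (x : TF k H V) :
    dif π e x = phi π e x - e (π x) := rfl

theorem dif_mul {π : TF k H V →ₐ[k] A} (hπ : Base π) {e : A ≃ₗ[k] Ac} (hs : Star π e)
    (m n : ℕ) (x y : TF k H V) (hx' : π x ∈ gE π m) (hy' : π y ∈ gE π n)
    (hx : dif π e x ∈ Submodule.map e.toLinearMap (lE π m))
    (hy : dif π e y ∈ Submodule.map e.toLinearMap (lE π n)) :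
    dif π e (x * y) ∈ Submodule.map e.toLinearMap (lE π (m + n)) := by
  have ex : e (π x) ∈ Submodule.map e.toLinearMap (lE π (m+1)) :=
    ⟨_, gE_le π (by omega) hx', rfl⟩
  have ey : e (π y) ∈ Submodule.map e.toLinearMap (lE π (n+1)) :=
    ⟨_, gE_le π (by omega) hy', rfl⟩
  have ey' : phi π e y ∈ Submodule.map e.toLinearMap (lE π (n+1)) := by
    have := Submodule.add_mem _ (Submodule.map_mono (lE_mono π (n := n+1) (by omega)) hy) ey
    simpa [dif_apply] using this
  have h1 := Lc_mul hπ hs m (n+1) (m+n) (by omega) (Submodule.mul_mem_mul hx ey')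
  have h2 := Lc_mul hπ hs (m+1) n (m+n) (by omega) (Submodule.mul_mem_mul ex hy)
  have h3 := hs.2 m n _ hx' _ hy'
  have h4 := Submodule.add_mem _ (Submodule.add_mem _ h1 h2) h3
  convert h4 using 1
  simp only [dif_apply, map_mul]
  noncomm_ring

theorem dif_jV (π : TF k H V →ₐ[k] A) (e : A ≃ₗ[k] Ac) (v : V) :
    dif π e (jV k H V v) = 0 := by simp [dif_apply, phi_jV]

theorem dif_jH (π : TF k H V →ₐ[k] A) (e : A ≃ₗ[k] Ac) (v : H) :
    dif π e (jH k H V v) = 0 := by simp [dif_apply, phi_jH]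

theorem mem_gE (π : TF k H V →ₐ[k] A) {n : ℕ} {x : TF k H V} (hx : x ∈ gradeF k H V n) :
    π x ∈ gE π n := ⟨x, hx, rfl⟩

theorem VH_le : VF k H V * HF k H V ≤ gradeF k H V 1 := by
  rw [grade_succ, grade_zero]
  calc _ = 1 * (VF k H V * HF k H V) := (one_mul _).symm
    _ ≤ _ := by gcongr; exact one_le_HF

theorem dif_grade {π : TF k H V →ₐ[k] A} (hπ : Base π) {e : A ≃ₗ[k] Ac} (hs : Star π e)
    (n : ℕ) (x : TF k H V) (hx : x ∈ gradeF k H V n) :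
    dif π e x ∈ Submodule.map e.toLinearMap (lE π n) := by
  induction n generalizing x with
  | zero =>
    rw [grade_zero] at hx
    rw [dif_apply, phi_HF π hs x hx, sub_self]; exact Submodule.zero_mem _
  | succ n ih =>
    have : gradeF k H V (n+1) ≤ (Submodule.map e.toLinearMap (lE π (n+1))).comap (dif π e) := by
      rw [grade_succ, Submodule.mul_le]
      intro a ha b hb
      refine dif_mul hπ hs n 1 a b (mem_gE π ha) (mem_gE π (VH_le hb)) (ih a ha) ?_
      have : VF k H V * HF k H V ≤ (Submodule.map e.toLinearMap (lE π 1)).comap (dif π e) := by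
        rw [Submodule.mul_le]
        rintro _ ⟨v, rfl⟩ y hy
        refine dif_mul hπ hs 1 0 _ y (mem_gE π (jV_mem v)) (mem_gE π (by rwa [grade_zero])) ?_ ?_
        · rw [dif_jV]; exact Submodule.zero_mem _
        · rw [dif_apply, phi_HF π hs y hy, sub_self]; exact Submodule.zero_mem _
      exact this hb
    exact this hx

theorem dif_iVH {π : TF k H V →ₐ[k] A} (hπ : Base π) {e : A ≃ₗ[k] Ac} (hs : Star π e)
    (r : V ⊗[k] H) : dif π e (iVH k H V r) ∈ Submodule.map e.toLinearMap (lE π 1) := by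
  induction r using TensorProduct.induction_on with
  | zero => simp
  | tmul x y =>
    refine dif_grade hπ hs 1 _ (VH_le ?_)
    exact Submodule.mul_mem_mul ⟨x, rfl⟩ (jH_mem y)
  | add x y hx hy => rw [map_add, map_add]; exact Submodule.add_mem _ hx hy

theorem dif_iVV {π : TF k H V →ₐ[k] A} (hπ : Base π) {e : A ≃ₗ[k] Ac} (hs : Star π e)
    (r : V ⊗[k] V) : dif π e (iVV k H V r) ∈ Submodule.map e.toLinearMap (lE π 2) := by
  induction r using TensorProduct.induction_on with
  | zero => simp
  | tmul x y =>
    refine dif_mul hπ hs 1 1 (jV k H V x) (jV k H V y) (mem_gE π (jV_mem _))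
      (mem_gE π (jV_mem _)) ?_ ?_
    · rw [dif_jV]; exact Submodule.zero_mem _
    · rw [dif_jV]; exact Submodule.zero_mem _
  | add x y hx hy => rw [map_add, map_add]; exact Submodule.add_mem _ hx hy

theorem dif_hv {π : TF k H V →ₐ[k] A} (hπ : Base π) {e : A ≃ₗ[k] Ac} (hs : Star π e)
    (h : H) (v : V) :
    dif π e (jH k H V h * jV k H V v) ∈ Submodule.map e.toLinearMap (lE π 1) := by
  refine dif_mul hπ hs 0 1 _ _ (mem_gE π (by rw [grade_zero]; exact jH_mem _))
      (mem_gE π (jV_mem _)) ?_ ?_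
  · rw [dif_jH]; exact Submodule.zero_mem _
  · rw [dif_jV]; exact Submodule.zero_mem _

theorem lE_phi {π : TF k H V →ₐ[k] A} (hπ : Base π) {e : A ≃ₗ[k] Ac} (hs : Star π e)
    (n : ℕ) : lE (phi π e) n = Submodule.map e.toLinearMap (lE π n) := by
  induction n with
  | zero => simp [lE_zero]
  | succ n ih =>
    have key : ∀ x ∈ gradeF k H V n, phi π e x - e (π x) ∈ lE (phi π e) n := by
      intro x hx; rw [ih]; exact dif_grade hπ hs n x hx
    rw [lE_succ, lE_succ, Submodule.map_sup, ← ih]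
    apply le_antisymm
    · refine sup_le le_sup_left ?_
      rintro _ ⟨x, hx, rfl⟩
      have := Submodule.add_mem_sup (key x hx) (Submodule.mem_map_of_mem (f := e.toLinearMap) (mem_gE π hx))
      simpa using this
    · refine sup_le le_sup_left ?_
      rintro _ ⟨_, ⟨x, hx, rfl⟩, rfl⟩
      have := Submodule.add_mem_sup (Submodule.neg_mem _ (key x hx)) (mem_gE (phi π e) hx)
      simpa using this

end comp

section core
variable {k H V : Type*} [Field k] [Ring H] [Bialgebra k H] [AddCommGroup V] [Module k V]

theorem exists_lift {M N P : Type*} [AddCommGroup M] [Module k M] [AddCommGroup N] [Module k N]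
    [AddCommGroup P] [Module k P] (f : M →ₗ[k] N) (g : P →ₗ[k] N)
    (h : ∀ x, g x ∈ LinearMap.range f) : ∃ l : P →ₗ[k] M, ∀ x, f (l x) = g x := by
  obtain ⟨l, hl⟩ := Module.projective_lifting_property f.rangeRestrict
    (g.codRestrict (LinearMap.range f) h) f.surjective_rangeRestrict
  exact ⟨l, fun x => congrArg Subtype.val (LinearMap.congr_fun hl x)⟩

variable (R : Submodule k (V ⊗[k] V)) (actV : H ⊗[k] V →ₗ[k] V)

/-- projection onto the smash product -/
noncomputable abbrev pr : TF k H V →ₐ[k] SmashAlg k H V R actV :=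
  RingQuot.mkAlgHom k (presRel k H V (fullRels k H V R actV))

theorem smash_gr {E : Type*} [Ring E] [Algebra k E] (f : TF k H V →ₐ[k] E) (y : TF k H V)
    (hy : y ∈ smashSet k H V actV) : grHom f y = Polynomial.monomial 1 (f y) := by
  have : Submodule.span k {x | ∃ (h : H) (v : V),
    x = jH k H V h * jV k H V v - iVH k H V (twistTau k H V actV (h ⊗ₜ[k] v))} ≤
      LinearMap.eqLocus (grHom f).toLinearMap
      ((Polynomial.monomial 1).restrictScalars k ∘ₗ f.toLinearMap) := by
    rw [Submodule.span_le]
    rintro _ ⟨h, v, rfl⟩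
    simp [grHom_iVH, grHom_jV, grHom_jH]
  exact this hy

theorem grHom_base {E : Type*} [Ring E] [Algebra k E] {f : TF k H V →ₐ[k] E} (hf : Base f) :
    Base (grHom f) := by
  refine ⟨fun h h' => ?_, ?_⟩
  · simp [grHom_jH, ← hf.1]
  · simp [grHom_jH, hf.2]

/-- directness of the grading on the smash product -/
theorem direct (n : ℕ) (x : TF k H V) (hx : x ∈ gradeF k H V n)
    (h : pr R actV x ∈ lE (pr R actV) n) : pr R actV x = 0 := by
  have hb := grHom_base (base_mk (fullRels k H V R actV))
  have hrel : ∀ ⦃a b⦄, presRel k H V (fullRels k H V R actV) a b →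
      grHom (pr R actV) a = grHom (pr R actV) b := by
    intro a b hab
    cases hab with
    | mulH h h' => rw [map_mul]; exact hb.1 h h'
    | oneH => exact hb.2.trans (map_one _).symm
    | mem hm =>
      rw [map_zero]
      have h0 := mk_mem _ hm
      rcases hm with ⟨r, hr, rfl⟩ | hm
      · rw [grHom_mul', h0, Polynomial.monomial_zero_right]
      · rw [smash_gr _ _ _ hm, h0, Polynomial.monomial_zero_right]
  obtain ⟨y, hy, hxy⟩ := h
  have hxy : pr R actV x = pr R actV y := hxy.symm
  have h1 : grHom (pr R actV) x = grHom (pr R actV) y := by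
    have := congrArg (RingQuot.liftAlgHom k ⟨grHom (pr R actV), hrel⟩) hxy
    simpa only [RingQuot.liftAlgHom_mkAlgHom_apply] using this
  rw [grHom_grade _ n x hx] at h1
  have h2 : (grHom (pr R actV) y).coeff n = 0 := by
    have : filtFpred k H V n ≤ LinearMap.ker
        ((Polynomial.lcoeff (SmashAlg k H V R actV) n).restrictScalars k ∘ₗ
          (grHom (pr R actV)).toLinearMap) := by
      refine iSup₂_le fun i hi z hz => ?_
      have : n ≠ i := by omega
      simp [grHom_grade _ i z hz, Polynomial.coeff_monomial, hi.ne]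
    exact this hy
  rw [← h1, Polynomial.coeff_monomial, if_pos rfl] at h2
  exact h2

end core
end PBWAux
namespace PBWAux
section core2
variable {k H V : Type*} [Field k] [Ring H] [Bialgebra k H] [AddCommGroup V] [Module k V]
variable (R : Submodule k (V ⊗[k] V)) (actV : H ⊗[k] V →ₗ[k] V)

/-- Elements of the homogeneous ideal drop filtration degree in the deformed algebra. -/
theorem drop (lam : TF k H V →ₗ[k] TF k H V) (α β : V ⊗[k] V →ₗ[k] TF k H V)
    (hlam : ∀ x, lam x ∈ HF k H V) (hα : ∀ r, α r ∈ gradeF k H V 1)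
    (hβ : ∀ r, β r ∈ HF k H V) (n : ℕ) (x : TF k H V) (hx : x ∈ gradeF k H V n)
    (h0 : pr R actV x = 0) :
    RingQuot.mkAlgHom k (presRel k H V (defRels k H V R actV lam α β)) x ∈
      lE (RingQuot.mkAlgHom k (presRel k H V (defRels k H V R actV lam α β))) n := by
  set b := RingQuot.mkAlgHom k (presRel k H V (defRels k H V R actV lam α β)) with hb
  have hB : Base b := base_mk _
  have hG := grHom_base hB
  have hx' := mk_ker _ x h0
  suffices hmain : ∀ z ∈ twoSidedSpan k (baseSet k H V) ⊔
      twoSidedSpan k (fullRels k H V R actV), ∀ m, (grHom b z).coeff m ∈ lE b m by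
    have := hmain x hx' n
    rwa [grHom_grade _ n x hx, Polynomial.coeff_monomial, if_pos rfl] at this
  have gen : ∀ u p v : TF k H V, (∀ m, (grHom b p).coeff m ∈ lE b m) →
      ∀ m, (grHom b (u * p * v)).coeff m ∈ lE b m := by
    intro u p v hp m
    rw [map_mul, Polynomial.coeff_mul]
    refine Submodule.sum_mem _ fun q hq => ?_
    have hq := Finset.HasAntidiagonal.mem_antidiagonal.mp hq
    refine lE_mul hB q.1 (q.2 + 1) _ (by omega) (Submodule.mul_mem_mul ?_ (grHom_coeff hB v _))
    rw [map_mul, Polynomial.coeff_mul]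
    refine Submodule.sum_mem _ fun q' hq' => ?_
    have hq' := Finset.HasAntidiagonal.mem_antidiagonal.mp hq'
    exact lE_mul hB (q'.1 + 1) q'.2 _ (by omega)
      (Submodule.mul_mem_mul (grHom_coeff hB u _) (hp _))
  have hp1 : ∀ p ∈ baseSet k H V, ∀ m, (grHom b p).coeff m ∈ lE b m := by
    intro p hp m
    have : grHom b p = 0 := by
      rcases hp with ⟨h, h', rfl⟩ | rfl
      · rw [map_sub, map_mul, hG.1, sub_self]
      · rw [map_sub, hG.2, map_one, sub_self]
    rw [this, Polynomial.coeff_zero]; exact Submodule.zero_mem _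
  have hHF : ∀ y ∈ HF k H V, ∀ m, 0 < m → b y ∈ lE b m := fun y hy m hm =>
    gE_le b hm (mem_gE b (by rwa [grade_zero]))
  have hp2 : ∀ p ∈ fullRels k H V R actV, ∀ m, (grHom b p).coeff m ∈ lE b m := by
    intro p hp m
    rcases hp with ⟨r, hr, rfl⟩ | hp
    · rw [grHom_mul', Polynomial.coeff_monomial]
      split_ifs with h
      · subst h
        have h1 : b (iVV k H V r - α r - β r) = 0 := mk_mem _ (Or.inr ⟨r, hr, rfl⟩)
        have h2 : b (iVV k H V r) = b (α r) + b (β r) := by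
          rw [map_sub, map_sub, sub_sub, sub_eq_zero] at h1; exact h1
        rw [h2]
        exact Submodule.add_mem _ (gE_le b (by omega) (mem_gE b (hα r))) (hHF _ (hβ r) _ (by omega))
      · exact Submodule.zero_mem _
    · rw [smash_gr _ _ _ hp, Polynomial.coeff_monomial]
      split_ifs with h
      · subst h
        have h1 : b (p - lam p) = 0 := mk_mem _ (Or.inl ⟨p, hp, rfl⟩)
        rw [map_sub, sub_eq_zero] at h1
        rw [h1]
        exact hHF _ (hlam p) _ (by omega)
      · exact Submodule.zero_mem _
  intro z hz m
  have : twoSidedSpan k (baseSet k H V) ⊔ twoSidedSpan k (fullRels k H V R actV) ≤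
      (lE b m).comap ((Polynomial.lcoeff _ m).restrictScalars k ∘ₗ (grHom b).toLinearMap) := by
    refine sup_le ?_ ?_
    · rw [twoSidedSpan, Submodule.span_le]
      rintro _ ⟨u, p, v, hp, rfl⟩
      exact gen u p v (hp1 p hp) m
    · rw [twoSidedSpan, Submodule.span_le]
      rintro _ ⟨u, p, v, hp, rfl⟩
      exact gen u p v (hp2 p hp) m
  exact this hz

theorem kills {E : Type*} [Ring E] [Algebra k E] (f : TF k H V →ₐ[k] E) (s : Set (TF k H V))
    (hs : ∀ x ∈ s, f x = 0) (x : TF k H V) (hx : x ∈ twoSidedSpan k s) : f x = 0 := by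
  have : twoSidedSpan k s ≤ LinearMap.ker f.toLinearMap := by
    rw [twoSidedSpan, Submodule.span_le]
    rintro _ ⟨u, p, v, hp, rfl⟩
    simp [hs p hp]
  exact this hx

theorem core {Ac : Type*} [Ring Ac] [Algebra k Ac] (e : SmashAlg k H V R actV ≃ₗ[k] Ac)
    (hs : Star (pr R actV) e) :
    ∃ (lam : TF k H V →ₗ[k] TF k H V) (α β : V ⊗[k] V →ₗ[k] TF k H V),
      (∀ x, lam x ∈ HF k H V) ∧
      (∀ r : V ⊗[k] V, α r ∈ gradeF k H V 1) ∧
      (∀ r : V ⊗[k] V, β r ∈ HF k H V) ∧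
      IsStrongPBWofSmash k H V R actV lam α β ∧
      ∃ Θ : DefAlg k H V R actV lam α β ≃ₗ[k] Ac,
        Θ 1 = 1 ∧
        (∀ n, Submodule.map Θ.toLinearMap (filtB k H V R actV lam α β n)
          = Submodule.map e.toLinearMap (filtA k H V R actV n)) ∧
        (∀ (x y : DefAlg k H V R actV lam α β), Θ (x * y) = Θ x * Θ y) := by
  set π := pr R actV with hπd
  have hπ : Base π := base_mk _
  set φ := phi π e with hφd
  have hφ : Base φ := phi_base hπ hs
  have hL := lE_phi hπ hs
  -- lam
  have hsm : ∀ y ∈ smashSet k H V actV, φ y ∈ LinearMap.range (φ.toLinearMap ∘ₗ (HF k H V).subtype) := by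
    intro y hy
    have h1 : dif π e y ∈ Submodule.map e.toLinearMap (lE π 1) := by
      have : Submodule.span k {x | ∃ (h : H) (v : V),
          x = jH k H V h * jV k H V v - iVH k H V (twistTau k H V actV (h ⊗ₜ[k] v))} ≤
          (Submodule.map e.toLinearMap (lE π 1)).comap (dif π e) := by
        rw [Submodule.span_le]
        rintro _ ⟨h, v, rfl⟩
        change dif π e _ ∈ Submodule.map e.toLinearMap (lE π 1)
        rw [map_sub]
        exact Submodule.sub_mem (Submodule.map e.toLinearMap (lE π 1)) (dif_hv hπ hs h v) (dif_iVH hπ hs _)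
      exact this hy
    have h2 : π y = 0 := mk_mem _ (Or.inr hy)
    rw [dif_apply, h2, map_zero, sub_zero, ← hL, lE_succ, lE_zero, bot_sup_eq] at h1
    obtain ⟨z, hz, hzy⟩ := h1
    rw [grade_zero] at hz
    exact ⟨⟨z, hz⟩, hzy⟩
  let SM : Submodule k (TF k H V) := Submodule.span k {x | ∃ (h : H) (v : V),
          x = jH k H V h * jV k H V v - iVH k H V (twistTau k H V actV (h ⊗ₜ[k] v))}
  obtain ⟨l0, hl0⟩ := exists_lift (φ.toLinearMap ∘ₗ (HF k H V).subtype)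
    (φ.toLinearMap ∘ₗ SM.subtype) (fun y => hsm y.1 y.2)
  obtain ⟨l1, hl1⟩ := LinearMap.exists_extend l0
  let lam : TF k H V →ₗ[k] TF k H V := (HF k H V).subtype ∘ₗ l1
  have hlam : ∀ x, lam x ∈ HF k H V := fun x => (l1 x).2
  have hlam' : ∀ y ∈ smashSet k H V actV, φ (lam y) = φ y := by
    intro y hy
    have h1 := hl0 ⟨y, hy⟩
    have h2 := LinearMap.congr_fun hl1 ⟨y, hy⟩
    rw [← h2] at h1
    exact h1
  -- α, β
  obtain ⟨ab, hab⟩ := exists_lift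
    (LinearMap.coprod (φ.toLinearMap ∘ₗ (gradeF k H V 1).subtype)
      (φ.toLinearMap ∘ₗ (HF k H V).subtype)) (dif π e ∘ₗ iVV k H V) (by
      intro r
      have h1 := dif_iVV hπ hs r
      rw [← hL, lE_succ, lE_succ, lE_zero, bot_sup_eq] at h1
      obtain ⟨_, ⟨u, hu, rfl⟩, _, ⟨w, hw, rfl⟩, h⟩ := Submodule.mem_sup.mp h1
      rw [grade_zero] at hu
      refine ⟨(⟨w, hw⟩, ⟨u, hu⟩), ?_⟩
      rw [LinearMap.comp_apply, ← h, add_comm]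
      rfl)
  let α : V ⊗[k] V →ₗ[k] TF k H V := (gradeF k H V 1).subtype ∘ₗ LinearMap.fst k _ _ ∘ₗ ab
  let β : V ⊗[k] V →ₗ[k] TF k H V := (HF k H V).subtype ∘ₗ LinearMap.snd k _ _ ∘ₗ ab
  have hα : ∀ r, α r ∈ gradeF k H V 1 := fun r => (ab r).1.2
  have hβ : ∀ r, β r ∈ HF k H V := fun r => (ab r).2.2
  have hab' : ∀ r ∈ R, φ (iVV k H V r) = φ (α r) + φ (β r) := by
    intro r hr
    have h1 : φ (α r) + φ (β r) = dif π e (iVV k H V r) := hab r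
    have h2 : π (iVV k H V r) = 0 := mk_mem _ (Or.inl ⟨r, hr, rfl⟩)
    rw [h1, dif_apply, h2, map_zero, sub_zero]
  have hdef : ∀ x ∈ defRels k H V R actV lam α β, φ x = 0 := by
    rintro _ (⟨y, hy, rfl⟩ | ⟨r, hr, rfl⟩)
    · rw [map_sub, hlam' y hy, sub_self]
    · rw [map_sub, map_sub, hab' r hr]; abel
  have hbase : ∀ x ∈ baseSet k H V, φ x = 0 := by
    rintro _ (⟨h, h', rfl⟩ | rfl)
    · rw [map_sub, map_mul, hφ.1, sub_self]
    · rw [map_sub, hφ.2, map_one, sub_self]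
  have hzero : ∀ n, ∀ x ∈ gradeF k H V n, φ x ∈ lE φ n → π x = 0 := by
    intro n x hx h
    apply direct R actV n x hx
    have h1 := dif_grade hπ hs n x hx
    rw [hL] at h
    have h2 := Submodule.sub_mem _ h h1
    rw [dif_apply, sub_sub_cancel] at h2
    obtain ⟨z, hz, hzx⟩ := h2
    rwa [← e.injective hzx]
  refine ⟨lam, α, β, hlam, hα, hβ, ?_, ?_⟩
  · intro n x hx
    obtain ⟨hx1, hx2⟩ := hx
    apply mk_ker
    apply hzero n x hx1
    obtain ⟨u, hu, w, hw, rfl⟩ := Submodule.mem_sup.mp hx2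
    obtain ⟨u1, hu1, u2, hu2, rfl⟩ := Submodule.mem_sup.mp hu
    rw [map_add, map_add, kills φ _ hbase _ hu1, kills φ _ hdef _ hu2, zero_add, zero_add]
    exact ⟨w, hw, rfl⟩
  · set b := RingQuot.mkAlgHom k (presRel k H V (defRels k H V R actV lam α β)) with hbd
    have hB : Base b := base_mk _
    have hbs : Function.Surjective b := RingQuot.mkAlgHom_surjective k _
    have hrel : ∀ ⦃a b⦄, presRel k H V (defRels k H V R actV lam α β) a b → φ a = φ b := by
      intro a b hab
      cases hab with
      | mulH h h' => rw [map_mul]; exact hφ.1 h h'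
      | oneH => exact hφ.2.trans (map_one _).symm
      | mem hm => rw [map_zero]; exact hdef _ hm
    let Φ := RingQuot.liftAlgHom k ⟨φ, hrel⟩
    have hΦ : ∀ x, Φ (b x) = φ x := fun x => RingQuot.liftAlgHom_mkAlgHom_apply k φ hrel x
    have hinj0 : ∀ n, ∀ y ∈ filtFpred k H V n, φ y = 0 → b y = 0 := by
      intro n
      induction n with
      | zero =>
        intro y hy _
        rw [pred_zero, Submodule.mem_bot] at hy
        rw [hy, map_zero]
      | succ n ih =>
        intro y hy h0
        rw [pred_succ] at hy
        obtain ⟨w, hw, u, hu, rfl⟩ := Submodule.mem_sup.mp hy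
        have h1 : φ u ∈ lE φ n := by
          rw [map_add, add_comm, add_eq_zero_iff_eq_neg] at h0
          rw [h0]
          exact Submodule.neg_mem _ ⟨w, hw, rfl⟩
        obtain ⟨w', hw', hbw⟩ := drop R actV lam α β hlam hα hβ n u hu (hzero n u hu h1)
        have hbw : b w' = b u := hbw
        have h2 : b (w + u) = b (w + w') := by rw [map_add, map_add, hbw]
        rw [h2]
        apply ih _ (Submodule.add_mem _ hw hw')
        rw [← hΦ, ← h2, hΦ, h0]
    have hinj : Function.Injective Φ := by
      rw [injective_iff_map_eq_zero]
      intro x hx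
      obtain ⟨y, rfl⟩ := hbs x
      obtain ⟨n, z, hz, hzy⟩ := exhaust hB y
      have hzy : b z = b y := hzy
      rw [← hzy, hΦ] at hx
      rw [← hzy]
      exact hinj0 n z hz hx
    have hsurj : Function.Surjective Φ := by
      intro a
      obtain ⟨s, rfl⟩ := e.surjective a
      obtain ⟨y, rfl⟩ := RingQuot.mkAlgHom_surjective k _ s
      obtain ⟨n, hn⟩ := exhaust hπ y
      have h1 : e (π y) ∈ lE φ n := by rw [hL]; exact ⟨_, hn, rfl⟩
      obtain ⟨z, hz, hzy⟩ := h1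
      exact ⟨b z, (hΦ z).trans hzy⟩
    refine ⟨LinearEquiv.ofBijective Φ.toLinearMap ⟨hinj, hsurj⟩, ?_, ?_, ?_⟩
    · exact map_one Φ
    · intro n
      have h1 : Submodule.map e.toLinearMap (filtA k H V R actV n) = lE φ (n + 1) := by
        rw [hL, filtA, filtF_eq]; rfl
      have h2 : Submodule.map Φ.toLinearMap (filtB k H V R actV lam α β n) = lE φ (n + 1) := by
        rw [filtB, filtF_eq, ← Submodule.map_comp, lE]
        congr 1
        ext1 x
        exact hΦ x
      rw [h1, ← h2]
      rfl
    · intro x y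
      exact map_mul Φ x y

end core2
end PBWAux
namespace PBWAux
section star

theorem diag_sum {A : Type*} [AddCommGroup A] (f : ℕ → ℕ → A) (N : ℕ)
    (h : ∀ i j, N ≤ i ∨ N ≤ j → f i j = 0) :
    ∑ j ∈ Finset.range N, ∑ i ∈ Finset.range N, f i j =
      ∑ n ∈ Finset.range (2 * N), ∑ i ∈ Finset.range (n + 1), f i (n - i) := by
  have h1 : ∀ n, ∑ i ∈ Finset.range (n + 1), f i (n - i) =
      ∑ p ∈ (Finset.range N ×ˢ Finset.range N) with p.1 + p.2 = n, f p.1 p.2 := by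
    intro n
    rw [← Finset.Nat.sum_antidiagonal_eq_sum_range_succ f n]
    symm
    apply Finset.sum_subset
    · intro p hp
      rw [Finset.mem_filter] at hp
      exact Finset.HasAntidiagonal.mem_antidiagonal.mpr hp.2
    · intro p hp hn
      have hp := Finset.HasAntidiagonal.mem_antidiagonal.mp hp
      apply h
      by_contra hc
      push Not at hc
      exact hn (by simp [hp, hc.1, hc.2])
  simp only [h1]
  rw [Finset.sum_fiberwise_of_maps_to, Finset.sum_product_right]
  intro p hp
  simp only [Finset.mem_product, Finset.mem_range] at hp ⊢
  omega

variable {k A : Type*} [CommRing k] [Ring A] [Algebra k A]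
  (c : k) (μ : ℕ → A →ₗ[k] A →ₗ[k] A)

theorem fsum_eq {a b : A} (N : ℕ) (h : ∀ i, N ≤ i → μ i a b = 0) :
    ∑ᶠ i, c ^ i • μ i a b = ∑ i ∈ Finset.range N, c ^ i • μ i a b := by
  apply finsum_eq_sum_of_support_subset
  intro i hi
  by_contra hc
  simp only [Finset.coe_range, Set.mem_Iio, not_lt] at hc
  exact hi (by simp [h i hc])

/-- star product -/
noncomputable def st (hfin : ∀ a b, ∃ N, ∀ i, N ≤ i → μ i a b = 0) : A →ₗ[k] A →ₗ[k] A :=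
  LinearMap.mk₂ k (fun a b => ∑ᶠ i, c ^ i • μ i a b)
    (by
      intro a a' b
      obtain ⟨N, hN⟩ := hfin a b
      obtain ⟨N', hN'⟩ := hfin a' b
      have e1 : ∀ i, N + N' ≤ i → μ i a b = 0 := fun i hi => hN i (by omega)
      have e2 : ∀ i, N + N' ≤ i → μ i a' b = 0 := fun i hi => hN' i (by omega)
      rw [fsum_eq c μ _ e1, fsum_eq c μ _ e2,
        fsum_eq c μ (N + N') (fun i hi => by simp [e1 i hi, e2 i hi])]
      simp [Finset.sum_add_distrib])
    (by
      intro r a b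
      obtain ⟨N, hN⟩ := hfin a b
      rw [fsum_eq c μ _ hN, fsum_eq c μ N (fun i hi => by simp [hN i hi])]
      simp [Finset.smul_sum, smul_comm r])
    (by
      intro b a a'
      obtain ⟨N, hN⟩ := hfin b a
      obtain ⟨N', hN'⟩ := hfin b a'
      have e1 : ∀ i, N + N' ≤ i → μ i b a = 0 := fun i hi => hN i (by omega)
      have e2 : ∀ i, N + N' ≤ i → μ i b a' = 0 := fun i hi => hN' i (by omega)
      rw [fsum_eq c μ _ e1, fsum_eq c μ _ e2,
        fsum_eq c μ (N + N') (fun i hi => by simp [e1 i hi, e2 i hi])]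
      simp [Finset.sum_add_distrib])
    (by
      intro r a b
      obtain ⟨N, hN⟩ := hfin a b
      rw [fsum_eq c μ _ hN, fsum_eq c μ N (fun i hi => by simp [hN i hi])]
      simp [Finset.smul_sum, smul_comm r])

theorem st_eq (hfin : ∀ a b, ∃ N, ∀ i, N ≤ i → μ i a b = 0) {a b : A} (N : ℕ)
    (h : ∀ i, N ≤ i → μ i a b = 0) :
    st c μ hfin a b = ∑ i ∈ Finset.range N, c ^ i • μ i a b :=
  fsum_eq c μ N h

theorem st_assoc (hfin : ∀ a b, ∃ N, ∀ i, N ≤ i → μ i a b = 0)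
    (hfin3 : ∀ a b d, ∃ N, (∀ j, N ≤ j → μ j a b = 0) ∧ (∀ j, N ≤ j → μ j b d = 0) ∧
      (∀ i j, N ≤ i → μ i (μ j a b) d = 0) ∧ (∀ i j, N ≤ i → μ i a (μ j b d) = 0))
    (hassoc : ∀ (n : ℕ) (a b c),
      ∑ i ∈ Finset.range (n + 1), μ i (μ (n - i) a b) c
        = ∑ i ∈ Finset.range (n + 1), μ i a (μ (n - i) b c)) (a b d : A) :
    st c μ hfin (st c μ hfin a b) d = st c μ hfin a (st c μ hfin b d) := by
  obtain ⟨N, h1, h2, h3, h4⟩ := hfin3 a b d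
  have e1 : st c μ hfin (st c μ hfin a b) d =
      ∑ j ∈ Finset.range N, ∑ i ∈ Finset.range N, c ^ (i + j) • μ i (μ j a b) d := by
    rw [st_eq c μ hfin N h1, map_sum, LinearMap.sum_apply]
    refine Finset.sum_congr rfl fun j _ => ?_
    rw [map_smul, LinearMap.smul_apply, st_eq c μ hfin N (fun i hi => h3 i j hi), Finset.smul_sum]
    refine Finset.sum_congr rfl fun i _ => ?_
    rw [smul_smul, ← pow_add, add_comm]
  have e2 : st c μ hfin a (st c μ hfin b d) =
      ∑ j ∈ Finset.range N, ∑ i ∈ Finset.range N, c ^ (i + j) • μ i a (μ j b d) := by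
    rw [st_eq c μ hfin N h2, map_sum]
    refine Finset.sum_congr rfl fun j _ => ?_
    rw [map_smul, st_eq c μ hfin N (fun i hi => h4 i j hi), Finset.smul_sum]
    refine Finset.sum_congr rfl fun i _ => ?_
    rw [smul_smul, ← pow_add, add_comm]
  rw [e1, e2, diag_sum (fun i j => c ^ (i + j) • μ i (μ j a b) d),
    diag_sum (fun i j => c ^ (i + j) • μ i a (μ j b d))]
  · refine Finset.sum_congr rfl fun n _ => ?_
    have e3 : ∀ f : ℕ → A, ∑ i ∈ Finset.range (n + 1), c ^ (i + (n - i)) • f i =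
        c ^ n • ∑ i ∈ Finset.range (n + 1), f i := by
      intro f
      rw [Finset.smul_sum]
      refine Finset.sum_congr rfl fun i hi => ?_
      rw [Finset.mem_range] at hi
      congr 2; omega
    rw [e3 (fun i => μ i (μ (n - i) a b) d), e3 (fun i => μ i a (μ (n - i) b d)), hassoc]
  · rintro i j (h | h)
    · simp [h4 i j h]
    · simp [h2 j h]
  · rintro i j (h | h)
    · simp [h3 i j h]
    · simp [h1 j h]

/-- type synonym for the fiber -/
def Syn (A : Type*) := A

instance {A : Type*} [AddCommGroup A] : AddCommGroup (Syn A) := inferInstanceAs (AddCommGroup A)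

instance {k A : Type*} [Semiring k] [AddCommGroup A] [Module k A] : Module k (Syn A) :=
  inferInstanceAs (Module k A)

/-- identity -/
def toSyn (k A : Type*) [Semiring k] [AddCommGroup A] [Module k A] : A ≃ₗ[k] Syn A :=
  LinearEquiv.refl k A

/-- the ring structure on the fiber -/
@[reducible] noncomputable def synRing (s : A →ₗ[k] A →ₗ[k] A)
    (h1 : ∀ a, s 1 a = a) (h2 : ∀ a, s a 1 = a)
    (h3 : ∀ a b d, s (s a b) d = s a (s b d)) : Ring (Syn A) :=
  { (inferInstance : AddCommGroup (Syn A)) with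
    mul := fun a b => toSyn k A (s ((toSyn k A).symm a) ((toSyn k A).symm b))
    one := toSyn k A 1
    mul_assoc := fun a b d => h3 a b d
    one_mul := fun a => h1 a
    mul_one := fun a => h2 a
    zero_mul := fun a => LinearMap.map_zero₂ s a
    mul_zero := fun a => (s a).map_zero
    left_distrib := fun a b d => (s a).map_add b d
    right_distrib := fun a b d => LinearMap.map_add₂ s a b d }

end star
end PBWAux

/-- Let the Hopf algebra `H` act on the finitely generated quadratic algebra
`S = T(V)/(R)`, preserving the grading, and let `A = S#H`.  Let `A_t` be a graded
deformation of `A`, given by multiplication maps `μ i` of graded degree `-i` with `μ 0`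
the multiplication of `A`, associative in each `t`-degree, and unital.  Then for each
`c ∈ k`, the fiber `A_t|_{t=c}` (the algebra `A` with product `a ⋆_c b = Σ cⁱ μᵢ(a⊗b)`)
is isomorphic, as a filtered algebra, to a strong PBW deformation `H_{λ,α,β}` of `S#H`. -/
theorem stmt_14 {k H V : Type*} [Field k] [Ring H] [HopfAlgebra k H]
    [AddCommGroup V] [Module k V] [Module.Finite k V]
    (R : Submodule k (V ⊗[k] V))
    (actV : H ⊗[k] V →ₗ[k] V)
    (honeV : ∀ v : V, actV ((1 : H) ⊗ₜ[k] v) = v)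
    (hmulV : ∀ (h h' : H) (v : V),
      actV ((h * h') ⊗ₜ[k] v) = actV (h ⊗ₜ[k] actV (h' ⊗ₜ[k] v)))
    (hRpres : ∀ h : H, ∀ r ∈ R, diag2 k H V actV (h ⊗ₜ[k] r) ∈ R)
    (μ : ℕ → SmashAlg k H V R actV →ₗ[k] SmashAlg k H V R actV →ₗ[k] SmashAlg k H V R actV)
    (hμ0 : ∀ a b, μ 0 a b = a * b)
    (hunital : ∀ i, 1 ≤ i → ∀ a, μ i 1 a = 0 ∧ μ i a 1 = 0)
    (hdeg : ∀ (i m n : ℕ) (a b), a ∈ gradeA k H V R actV m → b ∈ gradeA k H V R actV n →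
      (i ≤ m + n → μ i a b ∈ gradeA k H V R actV (m + n - i)) ∧
      (m + n < i → μ i a b = 0))
    (hassoc : ∀ (n : ℕ) (a b c),
      ∑ i ∈ Finset.range (n + 1), μ i (μ (n - i) a b) c
        = ∑ i ∈ Finset.range (n + 1), μ i a (μ (n - i) b c))
    (c : k) :
    ∃ (lam : TF k H V →ₗ[k] TF k H V) (α β : V ⊗[k] V →ₗ[k] TF k H V),
      (∀ x, lam x ∈ HF k H V) ∧
      (∀ r : V ⊗[k] V, α r ∈ gradeF k H V 1) ∧
      (∀ r : V ⊗[k] V, β r ∈ HF k H V) ∧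
      IsStrongPBWofSmash k H V R actV lam α β ∧
      ∃ Θ : DefAlg k H V R actV lam α β ≃ₗ[k] SmashAlg k H V R actV,
        Θ 1 = 1 ∧
        (∀ n, Submodule.map Θ.toLinearMap (filtB k H V R actV lam α β n)
          = filtA k H V R actV n) ∧
        (∀ (x y : DefAlg k H V R actV lam α β) (m n : ℕ),
          Θ x ∈ filtA k H V R actV m → Θ y ∈ filtA k H V R actV n →
          Θ (x * y) = ∑ i ∈ Finset.range (m + n + 1), c ^ i • μ i (Θ x) (Θ y)) := by
  classical
  set π := PBWAux.pr R actV with hπd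
  have hπ : PBWAux.Base π := PBWAux.base_mk _
  have hg : ∀ n, gradeA k H V R actV n = PBWAux.gE π n := fun n => rfl
  have hf : ∀ n, filtA k H V R actV n = PBWAux.lE π (n + 1) := fun n => by
    rw [filtA, PBWAux.filtF_eq]; rfl
  -- bilinear extension
  have ext2 : ∀ (i m n : ℕ) (T : Submodule k (SmashAlg k H V R actV)),
      (∀ p q, p < m → q < n → ∀ a ∈ PBWAux.gE π p, ∀ b ∈ PBWAux.gE π q, μ i a b ∈ T) →
      ∀ a ∈ PBWAux.lE π m, ∀ b ∈ PBWAux.lE π n, μ i a b ∈ T := by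
    intro i m n T hT a ha b hb
    have h1 : ∀ p, p < m → ∀ a ∈ PBWAux.gE π p, μ i a b ∈ T := by
      intro p hp a ha
      have : PBWAux.lE π n ≤ T.comap (μ i a) := by
        rw [PBWAux.lE_eq]
        exact iSup₂_le fun q hq b hb => hT p q hp hq a ha b hb
      exact this hb
    have : PBWAux.lE π m ≤ T.comap ((μ i).flip b) := by
      rw [PBWAux.lE_eq]
      exact iSup₂_le fun p hp a ha => h1 p hp a ha
    exact this ha
  have hz : ∀ (i m n : ℕ), m + n ≤ i + 1 → ∀ a ∈ PBWAux.lE π m, ∀ b ∈ PBWAux.lE π n,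
      μ i a b = 0 := by
    intro i m n hi a ha b hb
    have := ext2 i m n ⊥ (by
      intro p q hp hq a ha b hb
      rw [(hdeg i p q a b ha hb).2 (by omega)]
      exact Submodule.zero_mem _) a ha b hb
    simpa using this
  have hm : ∀ (i m n : ℕ), ∀ a ∈ PBWAux.lE π m, ∀ b ∈ PBWAux.lE π n,
      μ i a b ∈ PBWAux.lE π (m + n) := by
    intro i m n
    apply ext2
    intro p q hp hq a ha b hb
    by_cases h : i ≤ p + q
    · exact PBWAux.gE_le π (by omega) ((hdeg i p q a b ha hb).1 h)
    · rw [(hdeg i p q a b ha hb).2 (by omega)]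
      exact Submodule.zero_mem _
  have hex : ∀ a : SmashAlg k H V R actV, ∃ n, a ∈ PBWAux.lE π n := by
    intro a
    obtain ⟨x, rfl⟩ := RingQuot.mkAlgHom_surjective k _ a
    exact PBWAux.exhaust hπ x
  have hfin : ∀ a b, ∃ N, ∀ i, N ≤ i → μ i a b = 0 := by
    intro a b
    obtain ⟨m, ha⟩ := hex a
    obtain ⟨n, hb⟩ := hex b
    exact ⟨m + n, fun i hi => hz i m n (by omega) a ha b hb⟩
  have hfin3 : ∀ a b d, ∃ N, (∀ j, N ≤ j → μ j a b = 0) ∧ (∀ j, N ≤ j → μ j b d = 0) ∧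
      (∀ i j, N ≤ i → μ i (μ j a b) d = 0) ∧ (∀ i j, N ≤ i → μ i a (μ j b d) = 0) := by
    intro a b d
    obtain ⟨m, ha⟩ := hex a
    obtain ⟨n, hb⟩ := hex b
    obtain ⟨r, hd⟩ := hex d
    refine ⟨m + n + r, fun j hj => hz j m n (by omega) a ha b hb,
      fun j hj => hz j n r (by omega) b hb d hd,
      fun i j hi => hz i (m + n) r (by omega) _ (hm j m n a ha b hb) d hd,
      fun i j hi => hz i m (n + r) (by omega) a ha _ (hm j n r b hb d hd)⟩
  let s := PBWAux.st c μ hfin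
  have hs1 : ∀ a, s 1 a = a := by
    intro a
    have h := PBWAux.st_eq c μ hfin (a := 1) (b := a) 1 (fun i hi => (hunital i hi a).1)
    simpa [hμ0] using h
  have hs2 : ∀ a, s a 1 = a := by
    intro a
    have h := PBWAux.st_eq c μ hfin (a := a) (b := 1) 1 (fun i hi => (hunital i hi a).2)
    simpa [hμ0] using h
  have hs3 := PBWAux.st_assoc c μ hfin hfin3 hassoc
  letI ringAc : Ring (PBWAux.Syn (SmashAlg k H V R actV)) := PBWAux.synRing s hs1 hs2 hs3
  letI algAc : Algebra k (PBWAux.Syn (SmashAlg k H V R actV)) :=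
    Algebra.ofModule (fun r x y => LinearMap.map_smul₂ s r x y) (fun r x y => (s x).map_smul r y)
  let e : SmashAlg k H V R actV ≃ₗ[k] PBWAux.Syn (SmashAlg k H V R actV) :=
    PBWAux.toSyn k _
  have hmul : ∀ a b, e a * e b = e (s a b) := fun a b => rfl
  have hstar : PBWAux.Star π e := by
    refine ⟨rfl, ?_⟩
    intro m n a ha b hb
    rw [hmul, ← map_sub]
    refine Submodule.mem_map_of_mem (f := e.toLinearMap) ?_
    have h1 : s a b = ∑ i ∈ Finset.range (m + n + 1), c ^ i • μ i a b :=
      PBWAux.st_eq c μ hfin (m + n + 1) (fun i hi => (hdeg i m n a b ha hb).2 (by omega))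
    rw [h1, Finset.sum_range_succ', pow_zero, one_smul, hμ0, add_sub_cancel_right]
    refine Submodule.sum_mem _ fun i hi => Submodule.smul_mem _ _ ?_
    rw [Finset.mem_range] at hi
    exact PBWAux.gE_le π (by omega) ((hdeg (i + 1) m n a b ha hb).1 (by omega))
  obtain ⟨lam, α, β, h1, h2, h3, h4, Θ, h5, h6, h7⟩ := PBWAux.core R actV e hstar
  refine ⟨lam, α, β, h1, h2, h3, h4, Θ.trans e.symm, ?_, ?_, ?_⟩
  · change e.symm (Θ 1) = 1
    rw [h5]; rfl
  · intro n
    have h8 : Submodule.map (Θ.trans e.symm).toLinearMap (filtB k H V R actV lam α β n) =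
        Submodule.map e.symm.toLinearMap
          (Submodule.map Θ.toLinearMap (filtB k H V R actV lam α β n)) := by
      rw [← Submodule.map_comp]; rfl
    rw [h8, h6, ← Submodule.map_comp]
    exact Submodule.map_id _
  · intro x y m n hx hy
    rw [hf] at hx hy
    have h9 : (Θ.trans e.symm) (x * y) = s ((Θ.trans e.symm) x) ((Θ.trans e.symm) y) := by
      change e.symm (Θ (x * y)) = _
      rw [h7]; rfl
    rw [h9]
    exact PBWAux.st_eq c μ hfin (m + n + 1) (fun i hi => hz i _ _ (by omega) _ hx _ hy)
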